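/- For real parameters c1, c2, c3, an integer N ≥ 0, and integers n, x with 0 ≤ n ≤ N and 0 ≤ x ≤ N, the renormalized Racah polynomials satisfy the contiguity difference equation μ⁺_n(c_{123}, c1; N) · p_n(x; c1,c2,c3; N) = B⁺(x; c1,c2,c3; N) · p_n(x+1; c1,c2,c3; N+1) − S⁺(x; c1,c2,c3; N) · p_n(x; c1,c2,c3; N+1) + D⁺(x; c1,c2,c3; N) · p_n(x−1; c1,c2,c3; N+1). -/

import Mathlib

open Finset

noncomputable section

/-- Pochhammer symbol `(a)_k = a (a+1) ⋯ (a+k-1)`. -/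
def poch (a : ℝ) (k : ℕ) : ℝ := ∏ i ∈ Finset.range k, (a + i)

/-- A real number is *generic* if it is not an integer. -/
def Generic (r : ℝ) : Prop := ∀ m : ℤ, r ≠ (m : ℝ)

/-- Genericity for three parameters: none of the parameters, nor any sum of two or three
of them, is an integer; this guarantees that no denominator vanishes. -/
def Generic3 (c1 c2 c3 : ℝ) : Prop :=
  Generic c1 ∧ Generic c2 ∧ Generic c3 ∧
  Generic (c1+c2) ∧ Generic (c1+c3) ∧ Generic (c2+c3) ∧
  Generic (c1+c2+c3)

/-- Genericity for four parameters: none of the parameters, nor any sum of two, three or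
four of them, is an integer; this guarantees that no denominator vanishes. -/
def Generic4 (c1 c2 c3 c4 : ℝ) : Prop :=
  Generic c1 ∧ Generic c2 ∧ Generic c3 ∧ Generic c4 ∧
  Generic (c1+c2) ∧ Generic (c1+c3) ∧ Generic (c1+c4) ∧
  Generic (c2+c3) ∧ Generic (c2+c4) ∧ Generic (c3+c4) ∧
  Generic (c1+c2+c3) ∧ Generic (c1+c2+c4) ∧ Generic (c1+c3+c4) ∧ Generic (c2+c3+c4) ∧
  Generic (c1+c2+c3+c4)

/-- Normalization `Ω(n; c1,c2,c3; M)`. -/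
def Om (n : ℤ) (c1 c2 c3 : ℝ) (M : ℤ) : ℝ :=
  (M.toNat.choose n.toNat : ℝ) * (2*(n:ℝ) + c2 + c3 + 1) *
    poch (c2+1) n.toNat * poch ((M:ℝ)+2+c1+c2+c3) n.toNat * poch (c1+1) (M-n).toNat /
    (poch (c3+1) n.toNat * poch (c2+c3+(n:ℝ)+1) (M.toNat+1))

/-- The renormalized Racah polynomial `p_n(x; c1,c2,c3; M)`, with the convention that it
vanishes unless `0 ≤ n ≤ M`. -/
def racah (n : ℤ) (x : ℝ) (c1 c2 c3 : ℝ) (M : ℤ) : ℝ :=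
  if 0 ≤ n ∧ n ≤ M then
    Om n c1 c2 c3 M *
      ∑ k ∈ Finset.range (n.toNat + 1),
        (poch (-(n:ℝ)) k * poch ((n:ℝ)+c2+c3+1) k * poch (-x) k * poch (x+c1+c2+1) k) /
        (poch (c2+1) k * poch ((M:ℝ)+2+c1+c2+c3) k * poch (-(M:ℝ)) k * (Nat.factorial k : ℝ))
  else 0

/-- Weight `Λ(x; c1,c2; M)`. -/
def Lam (x : ℤ) (c1 c2 : ℝ) (M : ℤ) : ℝ :=
  (-1:ℝ)^x.toNat * (M.toNat.choose x.toNat : ℝ) * (2*(x:ℝ)+c1+c2+1) * poch (c2+1) x.toNat /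
    (poch (c1+1) x.toNat * poch ((x:ℝ)+c1+c2+1) (M.toNat+1))

/-- `λ(x; c) = x(x+c+1)`. -/
def lam (x c : ℝ) : ℝ := x*(x+c+1)

/-- `μ_n(c) = n(n+c+1)`. -/
def mu (n c : ℝ) : ℝ := n*(n+c+1)

/-- Recurrence coefficient `A_n(c1,c2,c3; M)`. -/
def coefA (n c1 c2 c3 M : ℝ) : ℝ :=
  (n-M)*(n+c1+c2+c3+M+2)*(n+c2+1)*(n+c2+c3+1)/((2*n+c2+c3+1)*(2*n+c2+c3+2))

/-- Recurrence coefficient `C_n(c1,c2,c3; M)`. -/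
def coefC (n c1 c2 c3 M : ℝ) : ℝ :=
  n*(n-c1-M-1)*(n+c2+c3+M+1)*(n+c3)/((2*n+c2+c3)*(2*n+c2+c3+1))

/-- `Σ_n = A_n + C_n`. -/
def coefSig (n c1 c2 c3 M : ℝ) : ℝ := coefA n c1 c2 c3 M + coefC n c1 c2 c3 M

/-- Difference coefficient `B(x; c1,c2,c3; M)`. -/
def coefB (x c1 c2 c3 M : ℝ) : ℝ :=
  (x-M)*(x+c2+1)*(x+c1+c2+c3+M+2)*(x+c1+c2+1)/((2*x+c1+c2+1)*(2*x+c1+c2+2))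

/-- Difference coefficient `D(x; c1,c2,c3; M)`. -/
def coefD (x c1 c2 c3 M : ℝ) : ℝ :=
  x*(x+c1)*(x-c3-M-1)*(x+c1+c2+M+1)/((2*x+c1+c2)*(2*x+c1+c2+1))

/-- `S = B + D`. -/
def coefS (x c1 c2 c3 M : ℝ) : ℝ := coefB x c1 c2 c3 M + coefD x c1 c2 c3 M

/-- `F(x; c1,c2)`. -/
def Ffun (x c1 c2 : ℝ) : ℝ :=
  (x+c2+1)*(x+c1+c2+1)/((2*x+c1+c2+1)*(2*x+c1+c2+2))

/-- `λ⁺(x; c12; M) = (x+c12+M+2)(x−M−1)`. -/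
def lamP (x c12 M : ℝ) : ℝ := (x+c12+M+2)*(x-M-1)

/-- `A⁺_n(c2,c3; M)`. -/
def Ap (n c2 c3 M : ℝ) : ℝ := -(n-M-1)*(n-M)*Ffun n c3 c2

/-- `C⁺_n(c2,c3; M) = A⁺_{−n−c23−1}(c2,c3; M)`. -/
def Cp (n c2 c3 M : ℝ) : ℝ := Ap (-n-c2-c3-1) c2 c3 M

/-- `Σ⁺_n = A⁺_n + C⁺_n + (M+1)(M+1+c3)`. -/
def Sp (n c2 c3 M : ℝ) : ℝ := Ap n c2 c3 M + Cp n c2 c3 M + (M+1)*(M+1+c3)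

/-- `λ⁻(x; c123, c3; M) = (x+c123+M+1)(x−M−c3)`. -/
def lamM (x c123 c3 M : ℝ) : ℝ := (x+c123+M+1)*(x-M-c3)

/-- `A⁻_n(c1,c2,c3; M)`. -/
def Am (n c1 c2 c3 M : ℝ) : ℝ := -(n+c1+c2+c3+M+1)*(n+c1+c2+c3+M+2)*Ffun n c3 c2

/-- `C⁻_n(c1,c2,c3; M) = A⁻_{−n−c23−1}(c1,c2,c3; M)`. -/
def Cm (n c1 c2 c3 M : ℝ) : ℝ := Am (-n-c2-c3-1) c1 c2 c3 M

/-- `Σ⁻_n = A⁻_n + C⁻_n + (M+c12+1)(M+c123+1)`. -/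
def Sm (n c1 c2 c3 M : ℝ) : ℝ :=
  Am n c1 c2 c3 M + Cm n c1 c2 c3 M + (M+c1+c2+1)*(M+c1+c2+c3+1)

/-- `μ⁺_n(c123, c1; M) = (n+c123+M+2)(n−M−1−c1)`. -/
def muP (n c123 c1 M : ℝ) : ℝ := (n+c123+M+2)*(n-M-1-c1)

/-- `B⁺(x; c1,c2,c3; M)`. -/
def Bp (x c1 c2 c3 M : ℝ) : ℝ := -(x+c1+c2+c3+M+2)*(x+c1+c2+c3+M+3)*Ffun x c1 c2

/-- `D⁺(x; c1,c2,c3; M) = B⁺(−x−c12−1; c1,c2,c3; M)`. -/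
def Dp (x c1 c2 c3 M : ℝ) : ℝ := Bp (-x-c1-c2-1) c1 c2 c3 M

/-- `S⁺ = B⁺ + D⁺ + (c23+M+2)(c123+M+2)`. -/
def SpD (x c1 c2 c3 M : ℝ) : ℝ :=
  Bp x c1 c2 c3 M + Dp x c1 c2 c3 M + (c2+c3+M+2)*(c1+c2+c3+M+2)

/-- `μ⁻_n(c23; M) = (n−M)(n+c23+M+1)`. -/
def muM (n c23 M : ℝ) : ℝ := (n-M)*(n+c23+M+1)

/-- `B⁻(x; c1,c2; M)`. -/
def Bm (x c1 c2 M : ℝ) : ℝ := -(x-M)*(x-M+1)*Ffun x c1 c2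

/-- `D⁻(x; c1,c2; M) = B⁻(−x−c12−1; c1,c2; M)`. -/
def Dm (x c1 c2 M : ℝ) : ℝ := Bm (-x-c1-c2-1) c1 c2 M

/-- `S⁻ = B⁻ + D⁻ + M(c1+M)`. -/
def SmD (x c1 c2 M : ℝ) : ℝ := Bm x c1 c2 M + Dm x c1 c2 M + M*(c1+M)

/-- Nine-point recurrence coefficients `A^{e,e'}_{i,j}(c1,c2,c3,c4)` (with
`c0 = −2N−3−c1−c2−c3−c4`). -/
def nineA (e e' : ℤ) (i j : ℝ) (c1 c2 c3 c4 N : ℝ) : ℝ :=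
  let c0 : ℝ := -2*N-3-c1-c2-c3-c4
  if e = 1 ∧ e' = 1 then -(Ffun (-j-c0-c4-1) c4 c0) * Cm i c1 c2 c3 (N-j+1)
  else if e = 0 ∧ e' = 1 then (Ffun (-j-c0-c4-1) c4 c0) * Sm i c1 c2 c3 (N-j+1)
  else if e = -1 ∧ e' = 1 then -(Ffun (-j-c0-c4-1) c4 c0) * Am i c1 c2 c3 (N-j+1)
  else if e = 1 ∧ e' = -1 then -(Ffun j c4 c0) * Cp i c2 c3 (N-j-1)
  else if e = 0 ∧ e' = -1 then (Ffun j c4 c0) * Sp i c2 c3 (N-j-1)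
  else if e = -1 ∧ e' = -1 then -(Ffun j c4 c0) * Ap i c2 c3 (N-j-1)
  else if e = 1 ∧ e' = 0 then (Ffun j c4 c0 + Ffun (-j-c0-c4-1) c4 c0) * coefC i c1 c2 c3 (N-j)
  else if e = 0 ∧ e' = 0 then
    -(Ffun j c4 c0 + Ffun (-j-c0-c4-1) c4 c0) *
      (coefSig i c1 c2 c3 (N-j) + (N-j)^2 + (c1+c2+c3+2)*(N-j) + (1/2)*(c3+1)*(c1+c2+c3+1))
  else if e = -1 ∧ e' = 0 then (Ffun j c4 c0 + Ffun (-j-c0-c4-1) c4 c0) * coefA i c1 c2 c3 (N-j)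
  else 0

/-- `Γ^{0,0}_{i,j}(c1,c2,c3,c4)`. -/
def gam00 (i j : ℝ) (c1 c2 c3 c4 N : ℝ) : ℝ :=
  let c0 : ℝ := -2*N-3-c1-c2-c3-c4
  (-(coefSig i c1 c2 c3 (N-j)) + coefSig j c1 c0 c4 (N-i) - (1/4)*(c3^2-c4^2)
    + (i-N-(1/2)*(c4+1))*(i+(1/2)*(c2+c3-c0-c1))
    - (j-N-(1/2)*(c3+1))*(j+(1/2)*(c0+c4-c1-c2)))

/-- `Γ^{e,e'}_{i,j}` coefficients. -/
def gam (e e' : ℤ) (i j : ℝ) (c1 c2 c3 c4 N : ℝ) : ℝ :=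
  let c0 : ℝ := -2*N-3-c1-c2-c3-c4
  if e = 0 ∧ e' = 1 then coefC j c1 c0 c4 (N-i)
  else if e = 0 ∧ e' = -1 then coefA j c1 c0 c4 (N-i)
  else if e = 1 ∧ e' = 0 then coefC i c1 c2 c3 (N-j)
  else if e = -1 ∧ e' = 0 then coefA i c1 c2 c3 (N-j)
  else if e = 0 ∧ e' = 0 then gam00 i j c1 c2 c3 c4 N
  else 0

/-- Nine-point difference coefficients `D^{e,e'}(x,y; c1,c2,c3,c4)` (with
`c0 = −2N−3−c1−c2−c3−c4`). -/
def nineD (e e' : ℤ) (x y : ℝ) (c1 c2 c3 c4 N : ℝ) : ℝ :=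
  let c0 : ℝ := -2*N-3-c1-c2-c3-c4
  if e = 1 ∧ e' = 1 then -(Ffun x c1 c2) * Bm y c3 c0 (N-x)
  else if e = 1 ∧ e' = 0 then (Ffun x c1 c2) * SmD y c3 c0 (N-x)
  else if e = 1 ∧ e' = -1 then -(Ffun x c1 c2) * Dm y c3 c0 (N-x)
  else if e = -1 ∧ e' = 1 then -(Ffun (-x-c1-c2-1) c1 c2) * Bp y c3 c0 c4 (N-x)
  else if e = -1 ∧ e' = 0 then (Ffun (-x-c1-c2-1) c1 c2) * SpD y c3 c0 c4 (N-x)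
  else if e = -1 ∧ e' = -1 then -(Ffun (-x-c1-c2-1) c1 c2) * Dp y c3 c0 c4 (N-x)
  else if e = 0 ∧ e' = 1 then (Ffun x c1 c2 + Ffun (-x-c1-c2-1) c1 c2) * coefB y c3 c0 c4 (N-x)
  else if e = 0 ∧ e' = 0 then
    -(Ffun x c1 c2 + Ffun (-x-c1-c2-1) c1 c2) *
      (coefS y c3 c0 c4 (N-x) + (N-x)^2 + (c0+c3+c4+2)*(N-x) + (1/2)*(c3+1)*(c0+c3+c4+1))
  else if e = 0 ∧ e' = -1 then (Ffun x c1 c2 + Ffun (-x-c1-c2-1) c1 c2) * coefD y c3 c0 c4 (N-x)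
  else 0

/-- `Ψ^{a,b}(x,y)` coefficients: the first superscript refers to the shift in `y`,
the second to the shift in `x` (with `c0 = −2N−3−c1−c2−c3−c4`). -/
def psi (a b : ℤ) (x y : ℝ) (c1 c2 c3 c4 N : ℝ) : ℝ :=
  let c0 : ℝ := -2*N-3-c1-c2-c3-c4
  if a = 0 ∧ b = 1 then coefB x c4 c2 c1 (N-y)
  else if a = 0 ∧ b = -1 then coefD x c4 c2 c1 (N-y)
  else if a = 1 ∧ b = 0 then coefB y c3 c0 c1 (N-x)
  else if a = -1 ∧ b = 0 then coefD y c3 c0 c1 (N-x)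
  else if a = 0 ∧ b = 0 then gam00 x y c1 c2 c4 c3 N
  else 0

/-- Tratnik polynomial of Racah type `T_{i,j}(x,y; c1,c2,c3,c4; N)`, set to `0` outside
the triangular domains. -/
def trat (c1 c2 c3 c4 : ℝ) (Nn : ℕ) (i j x y : ℤ) : ℝ :=
  let c0 : ℝ := -2*(Nn:ℝ)-3-c1-c2-c3-c4
  if 0 ≤ i ∧ 0 ≤ j ∧ i + j ≤ (Nn:ℤ) ∧ 0 ≤ x ∧ 0 ≤ y ∧ x + y ≤ (Nn:ℤ) then
    racah i (x:ℝ) c1 c2 c3 ((Nn:ℤ)-j) * racah j (y:ℝ) c3 c0 c4 ((Nn:ℤ)-x)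
  else 0

/-- Griffiths polynomial of Racah type `G_{i,j}(x,y; c1,c2,c3,c4; N)`, set to `0` outside
the triangular domains. -/
def grif (c1 c2 c3 c4 : ℝ) (Nn : ℕ) (i j x y : ℤ) : ℝ :=
  let c0 : ℝ := -2*(Nn:ℝ)-3-c1-c2-c3-c4
  if 0 ≤ i ∧ 0 ≤ j ∧ i + j ≤ (Nn:ℤ) ∧ 0 ≤ x ∧ 0 ≤ y ∧ x + y ≤ (Nn:ℤ) then
    ∑ a ∈ Finset.range (((Nn:ℤ)-j).toNat + 1),
      (-1:ℝ)^a * racah i (a:ℝ) c1 c2 c3 ((Nn:ℤ)-j) * racah j (y:ℝ) c3 c0 c4 ((Nn:ℤ)-(a:ℤ)) *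
        racah (a:ℤ) (x:ℝ) c4 c2 c1 ((Nn:ℤ)-y)
  else 0

/-- Krawtchouk polynomial `K_n(x; p; M)`, set to `0` unless `0 ≤ n ≤ M`. -/
def kraw (n : ℤ) (x : ℝ) (p : ℝ) (M : ℤ) : ℝ :=
  if 0 ≤ n ∧ n ≤ M then
    (M.toNat.choose n.toNat : ℝ) * (p/(1-p))^n.toNat *
      ∑ k ∈ Finset.range (n.toNat + 1),
        poch (-(n:ℝ)) k * poch (-x) k / (poch (-(M:ℝ)) k * (Nat.factorial k : ℝ)) * (1/p)^k
  else 0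

lemma poch_succ (a : ℝ) (k : ℕ) : poch a (k + 1) = poch a k * (a + k) :=
  Finset.prod_range_succ _ _

lemma poch_succ_left (a : ℝ) (k : ℕ) : poch a (k + 1) = a * poch (a + 1) k := by
  rw [poch, Finset.prod_range_succ', poch, mul_comm]
  push_cast
  simp only [add_zero, add_assoc, add_comm (1 : ℝ)]

lemma poch_ne_zero {a : ℝ} {k : ℕ} (h : ∀ i < k, a + i ≠ 0) : poch a k ≠ 0 :=
  Finset.prod_ne_zero_iff.2 fun i hi => h i (Finset.mem_range.1 hi)

lemma Generic.ne_zero_of_eq {r t : ℝ} (hr : Generic r) (m : ℤ) (ht : t = r + m) : t ≠ 0 := by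
  intro h
  apply hr (-m)
  push_cast
  linarith

lemma Generic.poch_ne_zero {r t : ℝ} (hr : Generic r) (m : ℤ) (ht : t = r + m) (k : ℕ) :
    poch t k ≠ 0 :=
  _root_.poch_ne_zero fun i _ => hr.ne_zero_of_eq (m + i) (by push_cast; linarith)

/-- The basis `(-x)_k (x+s+1)_k` of polynomials in `x(x+s+1)`. -/
def racahBasis (s x : ℝ) (k : ℕ) : ℝ := poch (-x) k * poch (x + s + 1) k

/-- The coefficient of `racahBasis` in the hypergeometric sum defining `racah`. -/
def racahCoeff (n : ℕ) (c1 c2 c3 : ℝ) (M k : ℕ) : ℝ :=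
  poch (-(n : ℝ)) k * poch ((n : ℝ) + c2 + c3 + 1) k /
    (poch (c2 + 1) k * poch ((M : ℝ) + 2 + c1 + c2 + c3) k * poch (-(M : ℝ)) k *
      (Nat.factorial k : ℝ))

lemma racah_eq_sum {n M : ℕ} (h : n ≤ M) (x c1 c2 c3 : ℝ) :
    racah n x c1 c2 c3 M = Om n c1 c2 c3 M *
      ∑ k ∈ Finset.range (n + 1), racahCoeff n c1 c2 c3 M k * racahBasis (c1 + c2) x k := by
  rw [racah, if_pos (by omega)]
  congr 1
  refine Finset.sum_congr (by simp) fun k _ => ?_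
  rw [racahCoeff, racahBasis, ← add_assoc]
  push_cast
  ring

/-- The contiguity difference operator is lower bidiagonal in `racahBasis`. -/
lemma contiguity_racahBasis {c1 c2 : ℝ} (hc : Generic (c1 + c2)) (c3 M : ℝ) (x : ℤ) (k : ℕ) :
    Bp x c1 c2 c3 M * racahBasis (c1 + c2) (x + 1) k
        - SpD x c1 c2 c3 M * racahBasis (c1 + c2) x k
        + Dp x c1 c2 c3 M * racahBasis (c1 + c2) (x - 1) k =
      -(M + 2 + c1 + c2 + c3 + k) * (M + 2 + c2 + c3 + k) * racahBasis (c1 + c2) x k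
        + k * (M + 1 + c1 + c2 + c3 + k) * (M + 2 + c1 + c2 + c3 + k) * (k + c2) *
          racahBasis (c1 + c2) x (k - 1) := by
  cases k with
  | zero =>
    simp only [racahBasis, poch, SpD, Finset.range_zero, Finset.prod_empty]
    push_cast
    ring
  | succ k =>
    have h0 : 2 * (x : ℝ) + c1 + c2 ≠ 0 :=
      hc.ne_zero_of_eq (2 * x) (by push_cast; ring)
    have h1 : 2 * (x : ℝ) + c1 + c2 + 1 ≠ 0 :=
      hc.ne_zero_of_eq (2 * x + 1) (by push_cast; ring)
    have h2 : 2 * (x : ℝ) + c1 + c2 + 2 ≠ 0 :=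
      hc.ne_zero_of_eq (2 * x + 2) (by push_cast; ring)
    generalize (x : ℝ) = x at *
    have hU : (x + (c1 + c2) + 1) * poch (x + 1 + (c1 + c2) + 1) (k + 1) =
        poch (x + (c1 + c2) + 1) k * (x + (c1 + c2) + 1 + k) * (x + (c1 + c2) + 2 + k) := by
      have := poch_succ_left (x + (c1 + c2) + 1) (k + 1)
      rw [poch_succ, poch_succ] at this
      rw [show x + 1 + (c1 + c2) + 1 = x + (c1 + c2) + 1 + 1 by ring, ← this]
      push_cast
      ring
    have hV : (-x) * poch (-(x - 1)) (k + 1) = poch (-x) k * (-x + k) * (-x + 1 + k) := by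
      have := poch_succ_left (-x) (k + 1)
      rw [poch_succ, poch_succ] at this
      rw [show -(x - 1) = -x + 1 by ring, ← this]
      push_cast
      ring
    have hW : poch (-(x + 1)) (k + 1) = -(x + 1) * poch (-x) k := by
      rw [poch_succ_left, show -(x + 1) + 1 = -x by ring]
    have hZ : poch (x - 1 + (c1 + c2) + 1) (k + 1) =
        (x + c1 + c2) * poch (x + (c1 + c2) + 1) k := by
      rw [poch_succ_left, show x - 1 + (c1 + c2) + 1 + 1 = x + (c1 + c2) + 1 by ring]
      ring
    simp only [racahBasis, Nat.add_sub_cancel]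
    rw [hW, hZ, poch_succ (-x), poch_succ (x + (c1 + c2) + 1)]
    generalize poch (x + 1 + (c1 + c2) + 1) (k + 1) = U at *
    generalize poch (-(x - 1)) (k + 1) = V at *
    generalize poch (-x) k = P at *
    generalize poch (x + (c1 + c2) + 1) k = Q at *
    have hB : Bp x c1 c2 c3 M = -(x + c1 + c2 + c3 + M + 2) * (x + c1 + c2 + c3 + M + 3) *
        (x + c2 + 1) / ((2 * x + c1 + c2 + 1) * (2 * x + c1 + c2 + 2)) *
        (x + (c1 + c2) + 1) := by
      rw [Bp, Ffun]
      ring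
    have hD : Dp x c1 c2 c3 M = (c3 + M + 1 - x) * (c3 + M + 2 - x) *
        (x + c1) / ((2 * x + c1 + c2 + 1) * (2 * x + c1 + c2)) * (-x) := by
      rw [Dp, Bp, Ffun,
        show (2 * (-x - c1 - c2 - 1) + c1 + c2 + 1) * (2 * (-x - c1 - c2 - 1) + c1 + c2 + 2) =
          (2 * x + c1 + c2 + 1) * (2 * x + c1 + c2) by ring]
      ring
    rw [SpD, hB, hD]
    push_cast
    generalize hb : -(x + c1 + c2 + c3 + M + 2) * (x + c1 + c2 + c3 + M + 3) *
        (x + c2 + 1) / ((2 * x + c1 + c2 + 1) * (2 * x + c1 + c2 + 2)) = b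
    generalize hd : (c3 + M + 1 - x) * (c3 + M + 2 - x) *
        (x + c1) / ((2 * x + c1 + c2 + 1) * (2 * x + c1 + c2)) = d
    have key : -b * (x + c1 + c2 + 1 + k) * (2 * x + c1 + c2 + 2) * (k + 1)
          + d * (-x + k) * (2 * x + c1 + c2) * (k + 1) =
        (-(M + 2 + c1 + c2 + c3 + k + 1) * (M + 2 + c2 + c3 + k + 1)
          + (c2 + c3 + M + 2) * (c1 + c2 + c3 + M + 2)) * (-x + k) * (x + c1 + c2 + 1 + k)
        + (k + 1) * (M + 2 + c1 + c2 + c3 + k) * (M + 3 + c1 + c2 + c3 + k) * (k + 1 + c2) := by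
      have hb' := (div_eq_iff (mul_ne_zero h1 h2)).1 hb
      have hd' := (div_eq_iff (mul_ne_zero h1 h0)).1 hd
      apply mul_left_cancel₀ h1
      linear_combination (x + c1 + c2 + 1 + k) * (k + 1) * hb' - (-x + k) * (k + 1) * hd'
    linear_combination (b * (-(x + 1) * P)) * hU + (d * (x + c1 + c2) * Q) * hV + P * Q * key

lemma Om_succ {c1 c2 c3 : ℝ} (hg : Generic3 c1 c2 c3) {n N : ℕ} (h : n ≤ N) :
    Om n c1 c2 c3 ((N + 1 : ℕ) : ℤ) * ((N + 1 - n) * (N + 2 + c1 + c2 + c3) *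
        (c2 + c3 + n + N + 2)) =
      Om n c1 c2 c3 N * ((N + 1) * (N + 2 + c1 + c2 + c3 + n) * (c1 + 1 + N - n)) := by
  obtain ⟨-, -, h3, -, -, h23, h123⟩ := hg
  obtain ⟨m, rfl⟩ := Nat.exists_eq_add_of_le h
  have hch : ((n + m + 1).choose n : ℝ) * (m + 1) = ((n + m).choose n : ℝ) * (n + m + 1) := by
    have := Nat.choose_mul_succ_eq (n + m) n
    rw [show n + m + 1 - n = m + 1 by omega] at this
    exact_mod_cast this.symm
  have hA := (poch_succ_left ((n + m : ℕ) + 2 + c1 + c2 + c3) n).symm.trans (poch_succ _ _)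
  have hd1 : poch (c3 + 1) n ≠ 0 := h3.poch_ne_zero 1 (by push_cast; ring) n
  have hd2 : poch (c2 + c3 + n + 1) (n + m + 1) ≠ 0 :=
    h23.poch_ne_zero (n + 1) (by push_cast; ring) _
  have hd3 : c2 + c3 + n + 1 + (n + m + 1) ≠ 0 :=
    h23.ne_zero_of_eq (n + 1 + (n + m + 1)) (by push_cast; ring)
  simp only [Om, Int.toNat_natCast, Int.cast_natCast]
  rw [show (((n + m + 1 : ℕ) : ℤ) - (n : ℤ)).toNat = m + 1 by omega,
    show (((n + m : ℕ) : ℤ) - (n : ℤ)).toNat = m by omega,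
    poch_succ (c1 + 1) m, poch_succ (c2 + c3 + n + 1) (n + m + 1),
    show ((n + m + 1 : ℕ) : ℝ) + 2 + c1 + c2 + c3 = (n + m : ℕ) + 2 + c1 + c2 + c3 + 1 by
      push_cast; ring]
  push_cast at hA ⊢
  generalize poch ((n : ℝ) + m + 2 + c1 + c2 + c3 + 1) n = A' at *
  generalize poch ((n : ℝ) + m + 2 + c1 + c2 + c3) n = A at *
  generalize ((n + m + 1).choose n : ℝ) = b' at *
  generalize ((n + m).choose n : ℝ) = b at *
  generalize poch (c2 + c3 + n + 1) (n + m + 1) = E at *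
  rw [div_mul_eq_mul_div, div_mul_eq_mul_div,
    div_eq_div_iff (mul_ne_zero hd1 (mul_ne_zero hd2 hd3)) (mul_ne_zero hd1 hd2)]
  linear_combination ((2 * n + c2 + c3 + 1) * poch (c2 + 1) n * poch (c1 + 1) m * (c1 + 1 + m) *
    (c2 + c3 + n + 1 + (n + m + 1)) * poch (c3 + 1) n * E) *
      (A' * (n + m + 2 + c1 + c2 + c3) * hch + b * (n + m + 1) * hA)

lemma racahCoeff_succ {c1 c2 c3 : ℝ} (hg : Generic3 c1 c2 c3) {n N k : ℕ} (hk : k ≤ N) :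
    racahCoeff n c1 c2 c3 (N + 1) (k + 1) * ((c2 + 1 + k) * (N + 3 + c1 + c2 + c3 + k) *
        (k - N - 1) * (k + 1)) =
      racahCoeff n c1 c2 c3 (N + 1) k * ((k - n) * (n + c2 + c3 + 1 + k)) := by
  obtain ⟨-, h2, -, -, -, -, h123⟩ := hg
  have hd1 : c2 + 1 + k ≠ 0 := h2.ne_zero_of_eq (1 + k) (by push_cast; ring)
  have hd2 : (N + 1 : ℕ) + 2 + c1 + c2 + c3 + k ≠ 0 :=
    h123.ne_zero_of_eq (N + 3 + k) (by push_cast; ring)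
  have hd3 : -((N + 1 : ℕ) : ℝ) + k ≠ 0 := by
    have : (k : ℝ) ≤ N := by exact_mod_cast hk
    push_cast
    linarith
  have hd4 : (k : ℝ) + 1 ≠ 0 := by positivity
  have hstep : racahCoeff n c1 c2 c3 (N + 1) (k + 1) = racahCoeff n c1 c2 c3 (N + 1) k *
      ((-n + k) * (n + c2 + c3 + 1 + k)) / ((c2 + 1 + k) * ((N + 1 : ℕ) + 2 + c1 + c2 + c3 + k) *
        (-((N + 1 : ℕ) : ℝ) + k) * (k + 1)) := by
    simp only [racahCoeff, poch_succ, Nat.factorial_succ, Nat.cast_mul, Nat.cast_add k 1,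
      Nat.cast_one, div_mul_eq_mul_div, div_div]
    congr 1 <;> ring
  rw [hstep, div_mul_eq_mul_div, div_eq_iff (mul_ne_zero (mul_ne_zero (mul_ne_zero hd1 hd2) hd3)
    hd4)]
  push_cast
  ring

lemma racahCoeff_succ_degree {c1 c2 c3 : ℝ} (hg : Generic3 c1 c2 c3) {n N k : ℕ} (hk : k ≤ N) :
    racahCoeff n c1 c2 c3 (N + 1) k * ((N + 2 + c1 + c2 + c3 + k) * (N + 1)) =
      racahCoeff n c1 c2 c3 N k * ((N + 2 + c1 + c2 + c3) * (N + 1 - k)) := by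
  obtain ⟨-, h2, -, -, -, -, h123⟩ := hg
  have hA := (poch_succ_left (N + 2 + c1 + c2 + c3) k).symm.trans (poch_succ _ _)
  have hB := (poch_succ_left (-((N + 1 : ℕ) : ℝ)) k).symm.trans (poch_succ _ _)
  have hd1 : poch (N + 2 + c1 + c2 + c3) k ≠ 0 :=
    h123.poch_ne_zero (N + 2) (by push_cast; ring) k
  have hd2 : poch ((N + 1 : ℕ) + 2 + c1 + c2 + c3) k ≠ 0 :=
    h123.poch_ne_zero (N + 3) (by push_cast; ring) k
  have hd3 (M : ℕ) (hM : k ≤ M) : poch (-(M : ℝ)) k ≠ 0 :=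
    poch_ne_zero fun i hi => by
      have : (i : ℝ) < M := by exact_mod_cast hi.trans_le hM
      linarith
  have hd4 := hd3 N hk
  have hd5 := hd3 (N + 1) (by omega)
  rw [show N + 2 + c1 + c2 + c3 + 1 = (N + 1 : ℕ) + 2 + c1 + c2 + c3 by push_cast; ring] at hA
  rw [show -((N + 1 : ℕ) : ℝ) + 1 = -(N : ℝ) by push_cast; ring] at hB
  have hd6 : poch (c2 + 1) k ≠ 0 := h2.poch_ne_zero 1 (by push_cast; ring) k
  have hd7 : (Nat.factorial k : ℝ) ≠ 0 := by positivity
  rw [racahCoeff, racahCoeff, div_mul_eq_mul_div, div_mul_eq_mul_div, div_eq_div_iff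
    (mul_ne_zero (mul_ne_zero (mul_ne_zero hd6 hd2) hd5) hd7)
    (mul_ne_zero (mul_ne_zero (mul_ne_zero hd6 hd1) hd4) hd7)]
  generalize poch ((N + 1 : ℕ) + 2 + c1 + c2 + c3) k = A' at *
  generalize poch (-((N + 1 : ℕ) : ℝ)) k = B' at *
  push_cast at hB
  linear_combination (poch (-(n : ℝ)) k * poch (n + c2 + c3 + 1) k * poch (c2 + 1) k *
    (Nat.factorial k : ℝ)) * (-(N + 1) * poch (-(N : ℝ)) k * hA -
      (N + 2 + c1 + c2 + c3) * A' * hB)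

/-- contiguity difference equation (`N → N+1`) for the renormalized
Racah polynomials. -/
theorem racah_contiguity_difference_plus
    (c1 c2 c3 : ℝ) (hgen : Generic3 c1 c2 c3)
    (N n x : ℤ) (hN : 0 ≤ N) (hn0 : 0 ≤ n) (hnN : n ≤ N) (hx0 : 0 ≤ x) (hxN : x ≤ N) :
    muP (n:ℝ) (c1+c2+c3) c1 (N:ℝ) * racah n (x:ℝ) c1 c2 c3 N =
      Bp (x:ℝ) c1 c2 c3 (N:ℝ) * racah n ((x:ℝ)+1) c1 c2 c3 (N+1)
        - SpD (x:ℝ) c1 c2 c3 (N:ℝ) * racah n (x:ℝ) c1 c2 c3 (N+1)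
        + Dp (x:ℝ) c1 c2 c3 (N:ℝ) * racah n ((x:ℝ)-1) c1 c2 c3 (N+1) := by
  lift N to ℕ using hN
  lift n to ℕ using hn0
  have hn : n ≤ N := by exact_mod_cast hnN
  rw [show (N : ℤ) + 1 = ((N + 1 : ℕ) : ℤ) by push_cast; rfl]
  simp only [racah_eq_sum hn, racah_eq_sum (hn.trans N.le_succ), Int.cast_natCast]
  set w := racahCoeff n c1 c2 c3 (N + 1) with hw
  set φ := racahBasis (c1 + c2) x with hφ
  set β : ℕ → ℝ := fun k => k * (N + 1 + c1 + c2 + c3 + k) * (N + 2 + c1 + c2 + c3 + k) *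
    (k + c2) with hβ
  have hlast : w (n + 1) = 0 := by simp [hw, racahCoeff, poch_succ]
  have hshift : ∑ k ∈ Finset.range (n + 1), w k * (β k * φ (k - 1)) =
      ∑ k ∈ Finset.range (n + 1), w (k + 1) * β (k + 1) * φ k := by
    rw [Finset.sum_range_succ', Finset.sum_range_succ _ n, hlast]
    simp [hβ, mul_assoc]
  have hcoeff (k : ℕ) (hk : k ≤ n) :
      muP n (c1 + c2 + c3) c1 N * (Om n c1 c2 c3 N * racahCoeff n c1 c2 c3 N k) =
        Om n c1 c2 c3 (N + 1 : ℕ) * (w k * (-(N + 2 + c1 + c2 + c3 + k) *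
          (N + 2 + c2 + c3 + k)) + w (k + 1) * β (k + 1)) := by
    have hN1 : (N : ℝ) + 1 ≠ 0 := by positivity
    have hNk : (N : ℝ) + 1 - k ≠ 0 := by
      have : (k : ℝ) ≤ N := by exact_mod_cast hk.trans hn
      linarith
    have hw1 := racahCoeff_succ hgen (n := n) (hk.trans hn)
    have hw2 := racahCoeff_succ_degree hgen (n := n) (hk.trans hn)
    have hOm := Om_succ hgen hn
    rw [← hw] at hw1 hw2
    apply mul_left_cancel₀ (mul_ne_zero hN1 hNk)
    simp only [hβ, muP]
    generalize Om n c1 c2 c3 (N + 1 : ℕ) = ω at *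
    push_cast
    linear_combination ω * (N + 1) * (N + 2 + c1 + c2 + c3 + k) * hw1 +
      ω * (N + 1 - n) * (c2 + c3 + n + N + 2) * hw2 +
      racahCoeff n c1 c2 c3 N k * (N + 1 - k) * hOm
  have hop (k : ℕ) := contiguity_racahBasis hgen.2.2.2.1 c3 N x k
  calc _ = ∑ k ∈ Finset.range (n + 1), muP n (c1 + c2 + c3) c1 N *
        (Om n c1 c2 c3 N * racahCoeff n c1 c2 c3 N k) * φ k := by
        simp only [Finset.mul_sum]
        exact Finset.sum_congr rfl fun k _ => by ring
    _ = Om n c1 c2 c3 (N + 1 : ℕ) * (∑ k ∈ Finset.range (n + 1), w k *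
          (-(N + 2 + c1 + c2 + c3 + k) * (N + 2 + c2 + c3 + k) * φ k) +
          ∑ k ∈ Finset.range (n + 1), w k * (β k * φ (k - 1))) := by
        rw [hshift, ← Finset.sum_add_distrib, Finset.mul_sum]
        refine Finset.sum_congr rfl fun k hk => ?_
        rw [hcoeff k (Finset.mem_range_succ_iff.1 hk)]
        ring
    _ = Om n c1 c2 c3 (N + 1 : ℕ) * ∑ k ∈ Finset.range (n + 1), w k *
          (Bp x c1 c2 c3 N * racahBasis (c1 + c2) (x + 1) k - SpD x c1 c2 c3 N * φ k
            + Dp x c1 c2 c3 N * racahBasis (c1 + c2) (x - 1) k) := by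
        rw [← Finset.sum_add_distrib]
        congr 1
        refine Finset.sum_congr rfl fun k _ => ?_
        rw [hop k]
        ring
    _ = _ := by
        simp only [Finset.mul_sum]
        rw [← Finset.sum_sub_distrib, ← Finset.sum_add_distrib]
        exact Finset.sum_congr rfl fun k _ => by ring
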